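/- Let G be a gyrogroup and let N = N_l(G) be its left nucleus. Then (1) gyr[a,b](N) ⊆ N for all a,b∈G, and (2) N⊕a = a⊕N for all a∈G, where N⊕a = {n⊕a : n∈N} and a⊕N = {a⊕n : n∈N}. -/

import Mathlib

universe u v

/-- A gyrogroup: a groupoid `(G, +)` with a left identity `0`, left inverses `-a`,
gyroautomorphisms `gyr a b` (automorphisms of `(G, +)`) satisfying the left
gyroassociative law, and the left loop property. -/
class Gyrogroup (G : Type u) extends Add G, Zero G, Neg G where
  /-- (G1) left identity -/
  zero_add' : ∀ a : G, 0 + a = a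
  /-- (G2) left inverse -/
  neg_add' : ∀ a : G, -a + a = 0
  /-- (G3) the gyroautomorphisms, as bijections of `G` -/
  gyr : G → G → G ≃ G
  /-- (G3) each `gyr a b` preserves the operation, i.e. is an automorphism -/
  gyr_add' : ∀ a b x y : G, gyr a b (x + y) = gyr a b x + gyr a b y
  /-- (G3) left gyroassociative law -/
  add_gyr_assoc' : ∀ a b c : G, a + (b + c) = (a + b) + gyr a b c
  /-- (G4) left loop property -/
  left_loop' : ∀ a b : G, gyr (a + b) b = gyr a b

open Gyrogroup

variable {G : Type u}

/-- A subgyrogroup: a nonempty subset closed under the operation and inverses. -/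
structure IsSubgyrogroup [Gyrogroup G] (H : Set G) : Prop where
  nonempty : H.Nonempty
  add_mem : ∀ ⦃a : G⦄, a ∈ H → ∀ ⦃b : G⦄, b ∈ H → a + b ∈ H
  neg_mem : ∀ ⦃a : G⦄, a ∈ H → -a ∈ H

/-- A gyrogroup homomorphism: a map preserving the operation. -/
def IsGyroHom [Gyrogroup G] {A : Type v} [Gyrogroup A] (φ : G → A) : Prop :=
  ∀ x y : G, φ (x + y) = φ x + φ y

/-- The kernel of a map into a gyrogroup. -/
def gyroKer [Gyrogroup G] {A : Type v} [Gyrogroup A] (φ : G → A) : Set G :=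
  {x : G | φ x = 0}

/-- A normal subgyrogroup: the kernel of some gyrogroup homomorphism from `G`. -/
def IsNormalSubgyrogroup [Gyrogroup G] (N : Set G) : Prop :=
  IsSubgyrogroup N ∧ ∃ (A : Type u) (instA : Gyrogroup A) (φ : G → A),
    @IsGyroHom G _ A instA φ ∧ N = @gyroKer G _ A instA φ

/-- The gyrocommutator `[a, b] = -(a + b) + gyr a b (b + a)`. -/
def gyroCommutator [Gyrogroup G] (a b : G) : G :=
  -(a + b) + gyr a b (b + a)

/-- The set of all gyrocommutators of `G`. -/
def gyroCommutatorSet (G : Type u) [Gyrogroup G] : Set G :=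
  {x : G | ∃ a b : G, x = gyroCommutator a b}

/-- `K` is the commutator subgyrogroup `G'` of `G`: the smallest subgyrogroup
containing all commutators. -/
def IsCommutatorSubgyrogroup [Gyrogroup G] (K : Set G) : Prop :=
  IsSubgyrogroup K ∧ gyroCommutatorSet G ⊆ K ∧
    ∀ H : Set G, IsSubgyrogroup H → gyroCommutatorSet G ⊆ H → K ⊆ H

/-- `K` is the normal closure `⟨⟨A⟩⟩` of `A`: the smallest normal subgyrogroup
containing `A`. -/
def IsGyroNormalClosure [Gyrogroup G] (A K : Set G) : Prop :=
  IsNormalSubgyrogroup K ∧ A ⊆ K ∧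
    ∀ N : Set G, IsNormalSubgyrogroup N → A ⊆ N → K ⊆ N

/-- The left coset `a ⊕ H`. -/
def lcoset [Gyrogroup G] (a : G) (H : Set G) : Set G := (a + ·) '' H

/-- The right coset `H ⊕ a`. -/
def rcoset [Gyrogroup G] (H : Set G) (a : G) : Set G := (· + a) '' H

/-- A gyrogroup is gyrocommutative if `a + b = gyr a b (b + a)` for all `a, b`. -/
def IsGyrocommutative (G : Type u) [Gyrogroup G] : Prop :=
  ∀ a b : G, a + b = gyr a b (b + a)

/-- An L-subgyrogroup: a subgyrogroup with `gyr a h (H) = H` for all `a ∈ G`, `h ∈ H`. -/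
def IsLSubgyrogroup [Gyrogroup G] (H : Set G) : Prop :=
  IsSubgyrogroup H ∧ ∀ a : G, ∀ h ∈ H, ⇑(gyr a h) '' H = H

/-- A subgroup of a gyrogroup: a subgyrogroup that forms a group under the gyrogroup
operation (equivalently, on which the operation is associative; together with the
closure properties and the identity and inverses inherited from `G`, this makes it
a group). -/
def IsSubgroupOfGyrogroup [Gyrogroup G] (H : Set G) : Prop :=
  IsSubgyrogroup H ∧ ∀ a ∈ H, ∀ b ∈ H, ∀ c ∈ H, a + (b + c) = (a + b) + c

/-- The left nucleus of `G`. -/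
def leftNucleus (G : Type u) [Gyrogroup G] : Set G :=
  {a : G | ∀ b c : G, a + (b + c) = (a + b) + c}

/-- The middle nucleus of `G`. -/
def middleNucleus (G : Type u) [Gyrogroup G] : Set G :=
  {b : G | ∀ a c : G, a + (b + c) = (a + b) + c}

/-- The right nucleus of `G`. -/
def rightNucleus (G : Type u) [Gyrogroup G] : Set G :=
  {c : G | ∀ a b : G, a + (b + c) = (a + b) + c}

/-- `L(G)`: the set of left gyrotranslations of `G`, viewed as permutations of `G`.
A permutation `σ` is a left gyrotranslation when `σ x = a + x` for some fixed `a`. -/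
def LSet (G : Type u) [Gyrogroup G] : Set (Equiv.Perm G) :=
  {σ : Equiv.Perm G | ∃ a : G, ∀ x : G, σ x = a + x}

/-- `L(H)` for a subset `H ⊆ G`: the left gyrotranslations by elements of `H`. -/
def LSetOf [Gyrogroup G] (H : Set G) : Set (Equiv.Perm G) :=
  {σ : Equiv.Perm G | ∃ a ∈ H, ∀ x : G, σ x = a + x}

/-- The left multiplication group `LMlt(G)`: the subgroup of `Sym(G)` generated by
the left gyrotranslations. -/
def LMlt (G : Type u) [Gyrogroup G] : Subgroup (Equiv.Perm G) :=
  Subgroup.closure (LSet G)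

/-- `L(G)'`: the set of products `L_{a₁} ∘ ⋯ ∘ L_{aₙ}` of left gyrotranslations whose
reversed product `L_{aₙ} ∘ ⋯ ∘ L_{a₁}` is the identity. -/
def LPrime (G : Type u) [Gyrogroup G] : Set (Equiv.Perm G) :=
  {σ : Equiv.Perm G | ∃ l : List (Equiv.Perm G),
    (∀ τ ∈ l, τ ∈ LSet G) ∧ σ = l.prod ∧ l.reverse.prod = 1}

/-- `L(G)^# = ⋂_{a ∈ G} L_a ∘ L(G)`. -/
def LSharp (G : Type u) [Gyrogroup G] : Set (Equiv.Perm G) :=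
  {σ : Equiv.Perm G | ∀ ρ ∈ LSet G, ∃ τ ∈ LSet G, σ = ρ * τ}

/-- The radical of `G`: elements whose left gyrotranslation lies in `L(G)'`. -/
def gyroRadical (G : Type u) [Gyrogroup G] : Set G :=
  {a : G | ∃ σ ∈ LPrime G, ∀ x : G, σ x = a + x}

/-- `X` is a normal subgroup of the subgroup `Γ` (as a subset of the ambient group). -/
def IsNormalSubgroupIn {M : Type v} [Group M] (Γ : Subgroup M) (X : Set M) : Prop :=
  X ⊆ (Γ : Set M) ∧ (1 : M) ∈ X ∧ (∀ σ ∈ X, σ⁻¹ ∈ X) ∧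
    (∀ σ ∈ X, ∀ τ ∈ X, σ * τ ∈ X) ∧ ∀ γ ∈ Γ, ∀ σ ∈ X, γ * σ * γ⁻¹ ∈ X

/-- The coaddition `a ⊞ b = a + gyr a (-b) b`. -/
def gyroCoadd [Gyrogroup G] (a b : G) : G := a + gyr a (-b) b

/-- Natural-number multiples: `0 • a = 0`, `(m+1) • a = a + m • a`. -/
def gyroNsmul [Gyrogroup G] : ℕ → G → G
  | 0, _ => 0
  | n + 1, a => a + gyroNsmul n a

/-- The index `[G : H]`: the number of left cosets of `H` in `G`. -/
noncomputable def gyroIndex [Gyrogroup G] (H : Set G) : ℕ :=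
  Set.ncard {S : Set G | ∃ a : G, S = lcoset a H}

namespace Gyrogroup

theorem add_gyr [Gyrogroup G] (a b c : G) : (a + b) + gyr a b c = a + (b + c) :=
  (add_gyr_assoc' a b c).symm

theorem add_left_cancel [Gyrogroup G] {a b c : G} (h : a + b = a + c) : b = c := by
  apply (gyr (-a) a).injective
  rw [← zero_add' (gyr (-a) a b), ← zero_add' (gyr (-a) a c), ← neg_add' a, add_gyr, add_gyr, h]

theorem gyr_zero_left [Gyrogroup G] (a c : G) : gyr 0 a c = c := by
  apply add_left_cancel (a := a)
  have h := add_gyr 0 a c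
  rwa [zero_add', zero_add'] at h

theorem gyr_neg_left [Gyrogroup G] (a c : G) : gyr (-a) a c = c := by
  rw [← left_loop', neg_add', gyr_zero_left]

theorem neg_add_cancel_left [Gyrogroup G] (a b : G) : -a + (a + b) = b := by
  rw [← add_gyr, neg_add', zero_add', gyr_neg_left]

theorem add_neg_cancel_left [Gyrogroup G] (a b : G) : a + (-a + b) = b :=
  add_left_cancel (a := -a) (neg_add_cancel_left a _)

theorem add_zero [Gyrogroup G] (a : G) : a + 0 = a := by
  rw [← neg_add' a, add_neg_cancel_left]

theorem add_neg [Gyrogroup G] (a : G) : a + -a = 0 := by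
  rw [← add_zero (-a), add_neg_cancel_left]

theorem neg_neg [Gyrogroup G] (a : G) : - -a = a :=
  add_left_cancel (a := -a) ((add_neg (-a)).trans (neg_add' a).symm)

theorem gyr_zero_right [Gyrogroup G] (a b : G) : gyr a b 0 = 0 := by
  apply add_left_cancel (a := gyr a b 0)
  rw [← gyr_add', add_zero, add_zero]

theorem gyr_neg_add_gyr [Gyrogroup G] (a b c : G) : gyr (-a) (a + b) (gyr a b c) = c := by
  apply add_left_cancel (a := b)
  have h := add_gyr (-a) (a + b) (gyr a b c)
  rwa [neg_add_cancel_left, add_gyr, neg_add_cancel_left] at h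

theorem add_add_gyr_neg [Gyrogroup G] (a b : G) : (a + b) + gyr a b (-b) = a := by
  rw [add_gyr, add_neg, add_zero]

theorem gyr_gyr_neg [Gyrogroup G] (a b c : G) : gyr a (gyr a b (-b)) (gyr a b c) = c := by
  have hloop := left_loop' (a + b) (gyr a b (-b))
  rw [add_add_gyr_neg] at hloop
  have h := add_gyr (a + b) (gyr a b (-b)) (gyr a b c)
  rw [add_add_gyr_neg, ← gyr_add', add_gyr, add_neg_cancel_left] at h
  rw [hloop]
  exact add_left_cancel h

theorem exists_add_eq [Gyrogroup G] (b c : G) : ∃ a : G, a + b = c := by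
  refine ⟨c + gyr c b (-b), ?_⟩
  have h := add_gyr c (gyr c b (-b)) (gyr c b b)
  rwa [gyr_gyr_neg, ← gyr_add', neg_add', gyr_zero_right, add_zero] at h

theorem gyr_gyr_swap [Gyrogroup G] (a b c : G) : gyr b a (gyr a b c) = c := by
  obtain ⟨d, rfl⟩ := exists_add_eq b a
  have h := gyr_neg_add_gyr d b c
  rwa [← left_loop', neg_add_cancel_left, ← left_loop' d b] at h

theorem gyr_of_mem_leftNucleus [Gyrogroup G] {n : G} (hn : n ∈ leftNucleus G) (b c : G) :
    gyr n b c = c :=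
  add_left_cancel ((add_gyr n b c).trans (hn b c))

theorem add_add_of_mem_leftNucleus [Gyrogroup G] {n : G} (hn : n ∈ leftNucleus G) (a c : G) :
    a + (n + c) = (a + n) + c := by
  have h := gyr_gyr_swap n a c
  rw [gyr_of_mem_leftNucleus hn] at h
  rw [← add_gyr, h]

theorem gyr_mem_leftNucleus [Gyrogroup G] (a b : G) {n : G} (hn : n ∈ leftNucleus G) :
    gyr a b n ∈ leftNucleus G := by
  intro x y
  obtain ⟨x, rfl⟩ := (gyr a b).surjective x
  obtain ⟨y, rfl⟩ := (gyr a b).surjective y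
  simp only [← gyr_add', hn x y]

theorem gyr_add_right_of_mem_leftNucleus [Gyrogroup G] {n : G} (hn : n ∈ leftNucleus G)
    (y x c : G) : gyr y (x + n) c = gyr y x c := by
  apply add_left_cancel (a := y + (x + n))
  rw [add_gyr, ← add_add_of_mem_leftNucleus hn, ← add_gyr y x, ← add_gyr y x n, gyr_add',
    add_add_of_mem_leftNucleus (gyr_mem_leftNucleus y x hn)]

theorem gyr_add_left_of_mem_leftNucleus [Gyrogroup G] {n : G} (hn : n ∈ leftNucleus G)
    (x y c : G) : gyr (x + n) y c = gyr x y c := by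
  apply (gyr y x).injective
  rw [gyr_gyr_swap, ← gyr_add_right_of_mem_leftNucleus hn, gyr_gyr_swap]

theorem conj_add_of_mem_leftNucleus [Gyrogroup G] {n : G} (hn : n ∈ leftNucleus G) (a x : G) :
    (-a + (n + a)) + x = -a + (n + (a + x)) := by
  rw [add_add_of_mem_leftNucleus hn, add_add_of_mem_leftNucleus hn, ← add_gyr (-a + n),
    gyr_add_left_of_mem_leftNucleus hn, gyr_neg_left]

theorem conj_mem_leftNucleus [Gyrogroup G] {n : G} (hn : n ∈ leftNucleus G) (a : G) :
    -a + (n + a) ∈ leftNucleus G := by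
  intro b c
  rw [conj_add_of_mem_leftNucleus hn, conj_add_of_mem_leftNucleus hn, ← add_gyr a b,
    add_add_of_mem_leftNucleus hn, add_add_of_mem_leftNucleus hn, ← add_gyr (-a + n),
    gyr_add_left_of_mem_leftNucleus hn, gyr_neg_add_gyr]

end Gyrogroup

/-- the left nucleus `N = N_l(G)` satisfies
(1) `gyr a b (N) ⊆ N` for all `a, b ∈ G`, and (2) `N ⊕ a = a ⊕ N` for all `a ∈ G`. -/
theorem leftNucleus_gyr_invariant_and_cosets_commute (G : Type u) [Gyrogroup G] :
    (∀ a b : G, ⇑(gyr a b) '' leftNucleus G ⊆ leftNucleus G) ∧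
    (∀ a : G, rcoset (leftNucleus G) a = lcoset a (leftNucleus G)) := by
  refine ⟨?_, fun a => Set.Subset.antisymm ?_ ?_⟩
  · rintro a b _ ⟨n, hn, rfl⟩
    exact gyr_mem_leftNucleus a b hn
  · rintro _ ⟨n, hn, rfl⟩
    exact ⟨-a + (n + a), conj_mem_leftNucleus hn a, Gyrogroup.add_neg_cancel_left a _⟩
  · rintro _ ⟨n, hn, rfl⟩
    refine ⟨- -a + (n + -a), conj_mem_leftNucleus hn (-a), ?_⟩
    dsimp only
    rw [conj_add_of_mem_leftNucleus hn, Gyrogroup.neg_add', Gyrogroup.add_zero, Gyrogroup.neg_neg]
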